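/- arXiv:1703.09804 — 2 statements merged into one kernel-verified Lean document; each statement's English description precedes it below -/
import Mathlib

section
/- Let n ≥ 1 and let f₁, …, fₙ : [0,1] → ℝ be nonnegative integrable functions with ∫₀¹ fᵢ(x) dx = 1 for each i (densities of non-atomic probability measures on [0,1]). Then for every permutation σ of {1, …, n} there exist real numbers 0 = x₀ ≤ x₁ ≤ x₂ ≤ ⋯ ≤ x_{n-1} ≤ xₙ = 1 such that ∫_{x₀}^{x₁} f_{σ(1)}(x) dx = ∫_{x₁}^{x₂} f_{σ(2)}(x) dx = ⋯ = ∫_{x_{n-1}}^{xₙ} f_{σ(n)}(x) dx. In other words, an equitable and simple fair division of the cake [0,1] exists for any prescribed order of the players. -/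
/-- Let `F 0, …, F k` be continuous and monotone. Then every `[0, t]` can be cut into `k + 1`
consecutive intervals on which the successive functions have the same increment, and this common
increment can be chosen to be a continuous and monotone function of `t`. -/
theorem exists_equal_increments (F : ℕ → ℝ → ℝ) (hF : ∀ i, Monotone (F i))
    (hFc : ∀ i, Continuous (F i)) (k : ℕ) :
    ∃ g : ℝ → ℝ, g 0 = 0 ∧ MonotoneOn g (Set.Ici 0) ∧ ContinuousOn g (Set.Ici 0) ∧
      ∀ t, 0 ≤ t → ∃ x : ℕ → ℝ, x 0 = 0 ∧ x (k + 1) = t ∧ Monotone x ∧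
        ∀ i ≤ k, F i (x (i + 1)) - F i (x i) = g t := by
  induction k with
  | zero =>
    refine ⟨fun t => F 0 t - F 0 0, by simp, fun a _ b _ h => sub_le_sub_right (hF 0 h) _,
      ((hFc 0).sub continuous_const).continuousOn, fun t ht => ?_⟩
    refine ⟨fun i => if i = 0 then 0 else t, by simp, by simp, ?_, ?_⟩
    · refine monotone_nat_of_le_succ fun i => ?_
      by_cases hi : i = 0 <;> simp [hi, ht]
    · intro i hi
      obtain rfl : i = 0 := by omega
      simp
  | succ k ih =>
    obtain ⟨g, hg0, hgm, hgc, hgx⟩ := ih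
    have hcut : ∀ t, 0 ≤ t → ∃ s ∈ Set.Icc 0 t, g s + F (k + 1) s = F (k + 1) t := by
      intro t ht
      refine intermediate_value_Icc ht
        ((hgc.mono Set.Icc_subset_Ici_self).add (hFc (k + 1)).continuousOn) ⟨?_, ?_⟩
      · simpa [hg0] using hF (k + 1) ht
      · have := hgm (Set.mem_Ici.2 le_rfl) (Set.mem_Ici.2 ht) ht
        simp only [hg0] at this
        simpa using this
    choose! s hs hsF using hcut
    have hincr : ∀ a b, 0 ≤ a → a ≤ b →
        g (s a) ≤ g (s b) ∧ g (s b) - g (s a) ≤ F (k + 1) b - F (k + 1) a := by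
      intro a b ha hab
      have hb := ha.trans hab
      have h₁ := hsF a ha
      have h₂ := hsF b hb
      have h₃ := hF (k + 1) hab
      rcases le_total (s a) (s b) with h | h
      · have := hgm (hs a ha).1 (hs b hb).1 h
        have := hF (k + 1) h
        constructor <;> linarith
      · have := hgm (hs b hb).1 (hs a ha).1 h
        have := hF (k + 1) h
        constructor <;> linarith
    refine ⟨fun t => g (s t), ?_, fun a ha b _ h => (hincr a b ha h).1, ?_, fun t ht => ?_⟩
    · have h := hs 0 le_rfl
      have h0 : s 0 = 0 := le_antisymm h.2 h.1
      simp [h0, hg0]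
    · intro a ha
      have hlim := (hFc (k + 1)).continuousAt (x := a) |>.mono_left
        (nhdsWithin_le_nhds (s := Set.Ici 0))
      rw [ContinuousWithinAt, tendsto_iff_dist_tendsto_zero]
      refine squeeze_zero' (Filter.Eventually.of_forall fun _ => dist_nonneg) ?_
        (tendsto_iff_dist_tendsto_zero.1 hlim)
      filter_upwards [self_mem_nhdsWithin] with b hb
      simp only [Real.dist_eq]
      rcases le_total a b with h | h
      · obtain ⟨h₁, h₂⟩ := hincr a b ha h
        rwa [abs_of_nonneg (sub_nonneg.2 h₁), abs_of_nonneg (sub_nonneg.2 (hF _ h))]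
      · obtain ⟨h₁, h₂⟩ := hincr b a hb h
        rw [abs_sub_comm, abs_sub_comm (F (k + 1) b)]
        rwa [abs_of_nonneg (sub_nonneg.2 h₁), abs_of_nonneg (sub_nonneg.2 (hF _ h))]
    · obtain ⟨x, hx0, hxk, hxm, hx⟩ := hgx (s t) (hs t ht).1
      refine ⟨fun i => if i ≤ k + 1 then x i else t, by simp [hx0], by simp, ?_, ?_⟩
      · refine monotone_nat_of_le_succ fun i => ?_
        by_cases hi : i + 1 ≤ k + 1
        · simpa [hi, show i ≤ k + 1 by omega] using hxm (Nat.le_succ i)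
        · by_cases hi' : i ≤ k + 1
          · have := (hxm hi').trans (hxk.trans_le (hs t ht).2)
            simpa only [if_pos hi', if_neg hi] using this
          · simp only [if_neg hi', if_neg hi, le_refl]
      · intro i hi
        rcases Nat.lt_or_ge k i with h | h
        · obtain rfl : i = k + 1 := by omega
          have := hsF t ht
          simp only [le_refl, if_true, hxk, show ¬ k + 1 + 1 ≤ k + 1 by omega, if_false]
          linarith
        · simpa only [if_pos (show i ≤ k + 1 by omega), if_pos (show i + 1 ≤ k + 1 by omega)]
            using hx i h


/-- **Existence of an equitable and simple fair division.**
Given `n ≥ 1` players with densities `f i` on `[0,1]` (nonnegative, integrable,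
total integral 1) and a permutation `σ` prescribing the players' order, there
exist cut points `0 = x₀ ≤ x₁ ≤ ⋯ ≤ xₙ = 1` such that all the values
`∫_{x_{i-1}}^{x_i} f_{σ(i)}` coincide. -/
theorem equitable_simple_fair_division
    (n : ℕ) (hn : 1 ≤ n) (f : Fin n → ℝ → ℝ)
    (hint : ∀ i, MeasureTheory.IntegrableOn (f i) (Set.Icc (0:ℝ) 1))
    (hnonneg : ∀ i, ∀ x ∈ Set.Icc (0:ℝ) 1, 0 ≤ f i x)
    (hone : ∀ i, (∫ x in (0:ℝ)..1, f i x) = 1)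
    (σ : Equiv.Perm (Fin n)) :
    ∃ x : Fin (n + 1) → ℝ,
      x 0 = 0 ∧ x (Fin.last n) = 1 ∧ Monotone x ∧
      ∀ i j : Fin n,
        (∫ t in (x i.castSucc)..(x i.succ), f (σ i) t) =
        (∫ t in (x j.castSucc)..(x j.succ), f (σ j) t) := by
  obtain ⟨m, rfl⟩ : ∃ m, n = m + 1 := ⟨n - 1, by omega⟩
  let e : Fin (m + 1) → ℝ → ℝ := fun i => (Set.Icc (0 : ℝ) 1).indicator (f (σ i))
  have he : ∀ i, MeasureTheory.Integrable (e i) := fun i =>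
    (MeasureTheory.integrable_indicator_iff measurableSet_Icc).2 (hint (σ i))
  have he0 : ∀ i t, 0 ≤ e i t := fun i t =>
    Set.indicator_nonneg (fun y hy => hnonneg (σ i) y hy) t
  let F : ℕ → ℝ → ℝ := fun i t => ∫ y in (0 : ℝ)..t, e (Fin.ofNat (m + 1) i) y
  have hsub : ∀ i a b, F i b - F i a = ∫ y in a..b, e (Fin.ofNat (m + 1) i) y := fun i a b =>
    intervalIntegral.integral_interval_sub_left (he _).intervalIntegrable
      (he _).intervalIntegrable
  have hF : ∀ i, Monotone (F i) := fun i a b hab => by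
    rw [← sub_nonneg, hsub]
    exact intervalIntegral.integral_nonneg hab fun y _ => he0 _ y
  have hFc : ∀ i, Continuous (F i) := fun i =>
    intervalIntegral.continuous_primitive (fun _ _ => (he _).intervalIntegrable) 0
  obtain ⟨g, -, -, -, hg⟩ := exists_equal_increments F hF hFc m
  obtain ⟨x, hx0, hx1, hxm, hx⟩ := hg 1 zero_le_one
  have hval : ∀ i : Fin (m + 1), ∫ t in (x i)..(x (i + 1)), f (σ i) t = g 1 := by
    intro i
    rw [← hx i (by omega), hsub, Fin.ofNat_eq_cast, Fin.cast_val_eq_self]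
    refine intervalIntegral.integral_congr fun y hy => ?_
    rw [Set.uIcc_of_le (hxm (Nat.le_succ _))] at hy
    have hl : 0 ≤ x i := hx0 ▸ hxm (Nat.zero_le _)
    have hr : x (i + 1) ≤ 1 := hx1 ▸ hxm (by omega)
    exact (Set.indicator_of_mem (show y ∈ Set.Icc (0 : ℝ) 1 from
      ⟨hl.trans hy.1, hy.2.trans hr⟩) _).symm
  refine ⟨fun i => x i, by simpa using hx0, by simpa using hx1, fun i j h => hxm h,
    fun i j => ?_⟩
  simpa using (hval i).trans (hval j).symm
end

section
/- Let n ≥ 1, let f₁, …, fₙ : [0,1] → ℝ be nonnegative integrable functions with ∫₀¹ fᵢ = 1, and let σ be a permutation of {1, …, n}. Suppose ẽ = (ẽ₁, …, ẽₙ) ∈ S^{n-1} satisfies, for every i ∈ {1, …, n-1}, sgn(ẽ_{i+1}) · ∫_{ẽ₁²+⋯+ẽᵢ²}^{ẽ₁²+⋯+ẽᵢ²+ẽ_{i+1}²} f_{σ(i+1)}(x) dx = sgn(ẽ₁) · ∫₀^{ẽ₁²} f_{σ(1)}(x) dx. Then the points x₀ = 0 and xᵢ = x_{i-1} + ẽᵢ²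 for i = 1, …, n satisfy 0 = x₀ ≤ x₁ ≤ ⋯ ≤ xₙ = 1 and ∫_{x_{i-1}}^{xᵢ} f_{σ(i)}(x) dx = ∫₀^{x₁} f_{σ(1)}(x) dx for every i ∈ {1, …, n}, i.e. they solve the equitable-division system (⋆). -/
/-- A finite sequence with prescribed increments starting at `0` is given by partial sums. -/
theorem eq_sum_filter_castSucc_lt_of_step {M : Type*} [AddCommMonoid M] {n : ℕ}
    {x : Fin (n + 1) → M} {d : Fin n → M} (hx0 : x 0 = 0)
    (hxstep : ∀ i : Fin n, x i.succ = x i.castSucc + d i) (k : Fin (n + 1)) :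
    x k = ∑ j ∈ Finset.univ.filter (fun j : Fin n => j.castSucc < k), d j := by
  induction k using Fin.induction with
  | zero => simp [hx0]
  | succ i ih =>
    have hfilter : Finset.univ.filter (fun j : Fin n => j.castSucc < i.succ) =
        insert i (Finset.univ.filter fun j : Fin n => j.castSucc < i.castSucc) := by
      ext j
      simp only [Finset.mem_filter, Finset.mem_univ, true_and, Finset.mem_insert, Fin.lt_def,
        Fin.ext_iff, Fin.val_castSucc, Fin.val_succ]
      omega
    rw [hxstep, ih, hfilter, Finset.sum_insert (by simp), add_comm]

/-- For `g` nonnegative on `[s, s + a ^ 2]`, the factor `sign a` does not affect the absolute value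
of the integral of `g` over this interval, even when `a = 0`. -/
theorem abs_sign_mul_integral_add_sq {g : ℝ → ℝ} {s a : ℝ}
    (hg : ∀ t ∈ Set.Icc s (s + a ^ 2), 0 ≤ g t) :
    |Real.sign a * ∫ t in s..(s + a ^ 2), g t| = ∫ t in s..(s + a ^ 2), g t := by
  have hnonneg : 0 ≤ ∫ t in s..(s + a ^ 2), g t :=
    intervalIntegral.integral_nonneg (by nlinarith [sq_nonneg a]) hg
  rcases lt_trichotomy a 0 with ha | rfl | ha
  · rw [Real.sign_of_neg ha, neg_one_mul, abs_neg, abs_of_nonneg hnonneg]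
  · simp
  · rw [Real.sign_of_pos ha, one_mul, abs_of_nonneg hnonneg]


open Finset in
/-- **From a zero of the Borsuk–Ulam map to a solution of the system (⋆).**
If `ẽ ∈ S^{n-1}` satisfies `Fᵢ(ẽ) = 0` for all `i ∈ {1, …, n-1}` (written as an
equality of the two signed integrals; indices are 0-based, `k ≠ 0` playing the
role of `i+1`), then the points `x₀ = 0`, `xᵢ = x_{i-1} + ẽᵢ²
(= ẽ₁² + ⋯ + ẽᵢ²)` satisfy `0 = x₀ ≤ x₁ ≤ ⋯ ≤ xₙ = 1` and
`∫_{x_{i-1}}^{x_i} f_{σ(i)} = ∫₀^{x₁} f_{σ(1)}` for every `i`. -/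
theorem zero_of_F_gives_equitable_division
    (n : ℕ) (hn : 1 ≤ n) (f : Fin n → ℝ → ℝ)
    (hint : ∀ i, MeasureTheory.IntegrableOn (f i) (Set.Icc (0:ℝ) 1))
    (hnonneg : ∀ i, ∀ x ∈ Set.Icc (0:ℝ) 1, 0 ≤ f i x)
    (hone : ∀ i, (∫ x in (0:ℝ)..1, f i x) = 1)
    (σ : Equiv.Perm (Fin n))
    (e : Fin n → ℝ) (he : (∑ i, (e i) ^ 2) = 1)
    (hF : ∀ k : Fin n, k ≠ ⟨0, hn⟩ →
      Real.sign (e k) *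
        (∫ t in (∑ j ∈ univ.filter (· < k), (e j) ^ 2)..
                ((∑ j ∈ univ.filter (· < k), (e j) ^ 2) + (e k) ^ 2),
            f (σ k) t)
      = Real.sign (e ⟨0, hn⟩) *
          (∫ t in (0:ℝ)..((e ⟨0, hn⟩) ^ 2), f (σ ⟨0, hn⟩) t))
    (x : Fin (n + 1) → ℝ)
    (hx0 : x 0 = 0)
    (hxstep : ∀ i : Fin n, x i.succ = x i.castSucc + (e i) ^ 2) :
    x 0 = 0 ∧ x (Fin.last n) = 1 ∧ Monotone x ∧
      ∀ i : Fin n,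
        (∫ t in (x i.castSucc)..(x i.succ), f (σ i) t) =
        (∫ t in (x (0 : Fin (n + 1)))..(x ⟨1, by omega⟩), f (σ ⟨0, hn⟩) t) := by
  have hsum := eq_sum_filter_castSucc_lt_of_step hx0 hxstep
  have hlast : x (Fin.last n) = 1 := by
    rw [hsum, ← he]
    simp [Fin.castSucc_lt_last]
  have hmono : Monotone x :=
    Fin.monotone_iff_le_succ.2 fun i => by rw [hxstep]; exact le_add_of_nonneg_right (sq_nonneg _)
  refine ⟨hx0, hlast, hmono, fun i => ?_⟩
  have habs (k : Fin n) :
      |Real.sign (e k) * ∫ t in (x k.castSucc)..(x k.succ), f (σ k) t| =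
        ∫ t in (x k.castSucc)..(x k.succ), f (σ k) t := by
    have hk : ∀ t ∈ Set.Icc (x k.castSucc) (x k.succ), 0 ≤ f (σ k) t := fun t ht =>
      hnonneg _ t ⟨hx0 ▸ (hmono (Fin.zero_le _)).trans ht.1,
        hlast ▸ ht.2.trans (hmono (Fin.le_last _))⟩
    rw [hxstep] at hk ⊢
    exact abs_sign_mul_integral_add_sq hk
  have hzero : (⟨0, hn⟩ : Fin n).castSucc = 0 := rfl
  have hone' : (⟨1, by omega⟩ : Fin (n + 1)) = (⟨0, hn⟩ : Fin n).succ := rfl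
  rw [hone', ← hzero, ← habs i, ← habs ⟨0, hn⟩]
  by_cases hi : i = ⟨0, hn⟩
  · rw [hi]
  · have h := hF i hi
    have hcut : x i.castSucc = ∑ j ∈ univ.filter (· < i), (e j) ^ 2 := by
      simpa only [Fin.castSucc_lt_castSucc_iff] using hsum i.castSucc
    rw [← hcut, ← hxstep] at h
    rw [h, hxstep ⟨0, hn⟩, hzero, hx0, zero_add]
end
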